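/- Let k ≥ 1 and m ≥ 2 be integers and ℓ ∈ {1,...,k-1}. Suppose that a finite family 𝓕 of k-element sets contains no sunflower with m petals whose kernel has size ℓ. Then there exists a subfamily 𝓕' ⊆ 𝓕 with |𝓕'| ≥ c(k) · m^{-(k-ℓ)} · |𝓕| for some constant c(k) > 0 depending only on k, such that no two distinct members of 𝓕' intersect in exactly ℓ elements. -/

import Mathlib

/-- `A` is the kernel of a sunflower with `m` petals in `𝓕`. -/
def IsSunflowerKernel {α : Type*} [DecidableEq α] (𝓕 : Finset (Finset α)) (m : ℕ)
    (A : Finset α) : Prop :=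
  ∃ S ⊆ 𝓕, S.card = m ∧ ∀ F₁ ∈ S, ∀ F₂ ∈ S, F₁ ≠ F₂ → F₁ ∩ F₂ = A

open Finset in
/-- If no set of size `A.card` is the kernel of a sunflower with `m` petals, the members of a
`k`-uniform family containing `A` have their remainders outside `A` covered by at most `m * k`
points. -/
lemma exists_cover_of_not_isSunflowerKernel {α : Type*} [DecidableEq α] {𝓕 : Finset (Finset α)}
    {k m : ℕ} {A : Finset α} (h𝓕 : ∀ F ∈ 𝓕, F.card = k) (hA : A.card < k)
    (h : ¬ IsSunflowerKernel 𝓕 m A) :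
    ∃ T : Finset α, T.card ≤ m * k ∧ ∀ G ∈ 𝓕, A ⊆ G → ∃ v ∈ G, v ∈ T ∧ v ∉ A := by
  classical
  let P : Finset (Finset (Finset α)) := {S ∈ 𝓕.powerset |
    (∀ F ∈ S, A ⊆ F) ∧ ∀ F₁ ∈ S, ∀ F₂ ∈ S, F₁ ≠ F₂ → F₁ ∩ F₂ = A}
  obtain ⟨S, hSP, hmax⟩ := P.exists_max_image card ⟨∅, by simp [P]⟩
  obtain ⟨hS𝓕, hSA, hS⟩ : S ⊆ 𝓕 ∧ (∀ F ∈ S, A ⊆ F) ∧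
      ∀ F₁ ∈ S, ∀ F₂ ∈ S, F₁ ≠ F₂ → F₁ ∩ F₂ = A := by simpa [P] using hSP
  have hSm : S.card < m := by
    by_contra! hm
    obtain ⟨S', hS', hcard⟩ := exists_subset_card_eq hm
    exact h ⟨S', hS'.trans hS𝓕, hcard, fun F₁ h₁ F₂ h₂ => hS F₁ (hS' h₁) F₂ (hS' h₂)⟩
  refine ⟨S.biUnion id, ?_, fun G hG hAG => ?_⟩
  · exact (card_biUnion_le_card_mul S id k fun F hF => (h𝓕 F (hS𝓕 hF)).le).trans
      (Nat.mul_le_mul_right _ hSm.le)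
  by_cases hGS : G ∈ S
  · obtain ⟨v, hvG, hvA⟩ := exists_mem_notMem_of_card_lt_card (hA.trans_eq (h𝓕 G hG).symm)
    exact ⟨v, hvG, mem_biUnion.2 ⟨G, hGS, hvG⟩, hvA⟩
  by_contra! hcon
  have hdisj : ∀ F ∈ S, G ∩ F = A := fun F hF =>
    Subset.antisymm
      (fun v hv => hcon v (mem_inter.1 hv).1 (mem_biUnion.2 ⟨F, hF, (mem_inter.1 hv).2⟩))
      (subset_inter hAG (hSA F hF))
  have hins : insert G S ∈ P := by
    simp only [P, mem_filter, mem_powerset]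
    refine ⟨insert_subset hG hS𝓕, ?_, ?_⟩
    · intro F hF
      rcases mem_insert.1 hF with rfl | hF
      exacts [hAG, hSA F hF]
    · intro F₁ h₁ F₂ h₂ hne
      rcases mem_insert.1 h₁ with rfl | h₁' <;> rcases mem_insert.1 h₂ with rfl | h₂'
      · exact absurd rfl hne
      · exact hdisj F₂ h₂'
      · rw [inter_comm]; exact hdisj F₁ h₁'
      · exact hS F₁ h₁' F₂ h₂' hne
  have := hmax _ hins
  rw [card_insert_of_notMem hGS] at this
  omega

/-- A finite set with at most `k` elements can be labelled injectively by `Fin k`. -/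
lemma exists_injOn_fin {α : Type*} [DecidableEq α] {k : ℕ} (hk : 1 ≤ k) (F : Finset α)
    (hF : F.card = k) : ∃ e : α → Fin k, Set.InjOn e F := by
  let f := F.equivFinOfCardEq hF
  refine ⟨fun x => if h : x ∈ F then f ⟨x, h⟩ else ⟨0, hk⟩, fun x hx y hy hxy => ?_⟩
  have hx' : x ∈ F := hx
  have hy' : y ∈ F := hy
  simpa [hx', hy'] using hxy

/-- A Reed–Solomon code: `q ^ ℓ` words of length `k`, any two of which that agree in `ℓ` positions
are equal. -/
lemma exists_reedSolomon {k ℓ q : ℕ} [Fact q.Prime] (hkq : k ≤ q) :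
    ∃ P : (Fin ℓ → ZMod q) → Fin k → ZMod q, ∀ p p' : Fin ℓ → ZMod q, ∀ I : Finset (Fin k),
      ℓ ≤ I.card → (∀ i ∈ I, P p i = P p' i) → p = p' := by
  classical
  let E := Polynomial.degreeLTEquiv (ZMod q) ℓ
  have hinj : Function.Injective fun i : Fin k => ((i : ℕ) : ZMod q) := by
    intro i j hij
    have := (ZMod.natCast_eq_natCast_iff' _ _ _).1 hij
    rw [Nat.mod_eq_of_lt (i.2.trans_le hkq), Nat.mod_eq_of_lt (j.2.trans_le hkq)] at this
    exact Fin.ext this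
  refine ⟨fun p i => (E.symm p : Polynomial (ZMod q)).eval ((i : ℕ) : ZMod q), ?_⟩
  intro p p' I hI h
  have hdeg : ∀ r : Fin ℓ → ZMod q, (E.symm r : Polynomial (ZMod q)).degree <
      ((I.image fun i : Fin k => ((i : ℕ) : ZMod q)).card : ℕ) := by
    intro r
    rw [Finset.card_image_of_injective _ hinj]
    exact (Polynomial.mem_degreeLT.1 (E.symm r).2).trans_le (by exact_mod_cast hI)
  have := Polynomial.eq_of_degrees_lt_of_eval_finset_eq _ (hdeg p) (hdeg p') (by
    intro x hx
    obtain ⟨i, hi, rfl⟩ := Finset.mem_image.1 hx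
    exact h i hi)
  exact E.symm.injective (Subtype.ext this)

open Finset in
/-- The colours allowed at `v` when `F` is labelled by `e`, the codeword is `w`, and the points
of `U` outside `F` must deviate from `w`. -/
def allowedColours {α ι K : Type*} [DecidableEq α] [Fintype ι] [Fintype K] [DecidableEq K]
    (F U : Finset α) (e : α → ι) (w : ι → K) (v : α) : Finset (ι × K) :=
  if v ∈ F then {(e v, w (e v))}
  else if v ∈ U then univ.filter fun x => x.2 ≠ w x.1 else univ

open Finset in
lemma card_filter_snd_ne {ι K : Type*} [Fintype ι] [Fintype K] [DecidableEq K] (w : ι → K) :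
    (univ.filter fun x : ι × K => x.2 ≠ w x.1).card =
      Fintype.card ι * (Fintype.card K - 1) := by
  classical
  have : (univ.filter fun x : ι × K => x.2 ≠ w x.1) =
      (univ : Finset ι).biUnion fun i => ({w i}ᶜ : Finset K).image (Prod.mk i) := by
    ext ⟨i, c⟩
    simp
  rw [this, card_biUnion]
  · simp [card_image_of_injective _ (Prod.mk_right_injective _), card_compl]
  · intro i _ j _ hij
    rw [Function.onFun, disjoint_left]
    rintro ⟨a, b⟩ h₁ h₂
    simp only [mem_image, Prod.mk.injEq] at h₁ h₂
    obtain ⟨_, _, h₁, _⟩ := h₁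
    obtain ⟨_, _, h₂, _⟩ := h₂
    exact hij (h₁.trans h₂.symm)

open Finset in
/-- At least half of the expected number of colourings extends a prescribed colouring of `F` and
deviates from `w` on a small set `U`. -/
lemma le_card_piFinset_allowedColours {α ι K : Type*} [DecidableEq α] [Fintype ι] [Fintype K]
    [DecidableEq K] [Nonempty ι] [Nonempty K] {V F U : Finset α} (e : α → ι) (w : ι → K)
    (hFV : F ⊆ V) (hU : 2 * U.card ≤ Fintype.card K) :
    ((Fintype.card ι * Fintype.card K : ℕ) : ℝ) ^ V.card /
        (2 * ((Fintype.card ι * Fintype.card K : ℕ) : ℝ) ^ F.card) ≤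
      ((Fintype.piFinset fun v : V => allowedColours F U e w v).card : ℝ) := by
  set N : ℝ := ((Fintype.card ι * Fintype.card K : ℕ) : ℝ) with hN
  have hK : (0 : ℝ) < Fintype.card K := by exact_mod_cast Fintype.card_pos
  have hK1 : (1 : ℝ) ≤ Fintype.card K := by
    exact_mod_cast (Fintype.card_pos : 0 < Fintype.card K)
  have hNpos : 0 < N := by
    rw [hN]; exact_mod_cast Nat.mul_pos Fintype.card_pos Fintype.card_pos
  have hb0 : 0 ≤ 1 - (Fintype.card K : ℝ)⁻¹ := sub_nonneg.2 (inv_le_one_of_one_le₀ hK1)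
  have hb1 : 1 - (Fintype.card K : ℝ)⁻¹ ≤ 1 := by
    have := inv_pos.2 hK
    linarith
  have hcard : ((Fintype.piFinset fun v : V => allowedColours F U e w v).card : ℝ) =
      ∏ v ∈ V \ F, ((allowedColours F U e w v).card : ℝ) := by
    rw [Fintype.card_piFinset, prod_coe_sort V fun v => (allowedColours F U e w v).card,
      Nat.cast_prod, ← prod_sdiff hFV]
    rw [prod_eq_one (s := F), mul_one]
    intro v hv
    simp [allowedColours, hv]
  have hval : ∀ v ∈ V \ F, ((allowedColours F U e w v).card : ℝ) =
      N * if v ∈ U then 1 - (Fintype.card K : ℝ)⁻¹ else 1 := by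
    intro v hv
    have hvF := (mem_sdiff.1 hv).2
    by_cases hvU : v ∈ U
    · simp only [allowedColours, hvF, hvU, if_true, if_false, card_filter_snd_ne]
      rw [hN, Nat.cast_mul, Nat.cast_mul, Nat.cast_sub Fintype.card_pos]
      field_simp
      simp
    · simp [allowedColours, hvF, hvU, hN]
  rw [hcard, prod_congr rfl hval, prod_mul_distrib, prod_const, ← prod_filter, prod_const]
  have hhalf : (1 / 2 : ℝ) ≤
      (1 - (Fintype.card K : ℝ)⁻¹) ^ ((V \ F).filter fun v => v ∈ U).card := by
    have hle : ((V \ F).filter fun v => v ∈ U).card ≤ U.card :=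
      card_le_card fun v hv => (mem_filter.1 hv).2
    refine le_trans ?_ (pow_le_pow_of_le_one hb0 hb1 hle)
    have hB := one_add_mul_le_pow (a := -(Fintype.card K : ℝ)⁻¹) (by linarith) U.card
    rw [← sub_eq_add_neg] at hB
    refine le_trans ?_ hB
    have : (U.card : ℝ) * (Fintype.card K : ℝ)⁻¹ ≤ 1 / 2 := by
      rw [← div_eq_mul_inv, div_le_iff₀ hK]
      have : (2 * U.card : ℝ) ≤ Fintype.card K := by exact_mod_cast hU
      linarith
    linarith
  have hsplit : N ^ V.card = N ^ (V \ F).card * N ^ F.card := by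
    rw [← pow_add, card_sdiff_add_card_eq_card hFV]
  calc N ^ V.card / (2 * N ^ F.card) = N ^ (V \ F).card * (1 / 2) := by
        rw [hsplit]; field_simp
    _ ≤ _ := mul_le_mul_of_nonneg_left hhalf (by positivity)

open Finset in
/-- If each `F ∈ 𝓕` is selected by at least a proportion `δ` of the `χ`, some `χ` selects at least
a proportion `δ` of `𝓕`. -/
lemma exists_le_card_filter {β Ω : Type*} [Fintype Ω] [Nonempty Ω] (𝓕 : Finset β)
    (r : β → Ω → Prop) [∀ F, DecidablePred (r F)] [∀ χ, DecidablePred fun F => r F χ] {δ : ℝ}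
    (h : ∀ F ∈ 𝓕, δ * Fintype.card Ω ≤ ((univ.filter (r F)).card : ℝ)) :
    ∃ χ, δ * 𝓕.card ≤ ((𝓕.filter fun F => r F χ).card : ℝ) := by
  have hsum : ∑ _χ : Ω, δ * (𝓕.card : ℝ) ≤
      ∑ χ : Ω, ((𝓕.filter fun F => r F χ).card : ℝ) := by
    have hswap : ∑ χ : Ω, ((𝓕.filter fun F => r F χ).card : ℝ) =
        ∑ F ∈ 𝓕, ((univ.filter (r F)).card : ℝ) := by
      simp only [card_filter, Nat.cast_sum]
      rw [sum_comm]
    rw [hswap]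
    refine le_trans (le_of_eq ?_) (sum_le_sum h)
    simp only [sum_const, card_univ, nsmul_eq_mul]
    ring
  obtain ⟨χ, _, hχ⟩ := exists_le_of_sum_le univ_nonempty hsum
  exact ⟨χ, hχ⟩

open Finset in
/-- The selection argument with a fixed prime `q` as the number of colours. -/
lemma exists_subfamily_avoiding {α : Type*} [DecidableEq α] {k m ℓ q : ℕ} [Fact q.Prime]
    (hk : 1 ≤ k) (hℓ : ℓ < k) (hkq : k ≤ q) (hq : 2 * (2 ^ k * (m * k)) ≤ q)
    (𝓕 : Finset (Finset α)) (h𝓕 : ∀ F ∈ 𝓕, F.card = k)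
    (h : ∀ A : Finset α, A.card = ℓ → ¬ IsSunflowerKernel 𝓕 m A) :
    ∃ 𝓕' ⊆ 𝓕, (q : ℝ) ^ ℓ / (2 * ((k * q : ℕ) : ℝ) ^ k) * 𝓕.card ≤ 𝓕'.card ∧
      ∀ F₁ ∈ 𝓕', ∀ F₂ ∈ 𝓕', F₁ ≠ F₂ → (F₁ ∩ F₂).card ≠ ℓ := by
  classical
  have : Nonempty (Fin k) := ⟨⟨0, hk⟩⟩
  have hT : ∀ A : Finset α, ∃ T : Finset α, A.card = ℓ → T.card ≤ m * k ∧
      ∀ G ∈ 𝓕, A ⊆ G → ∃ v ∈ G, v ∈ T ∧ v ∉ A := by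
    intro A
    by_cases hA : A.card = ℓ
    · obtain ⟨T, hT⟩ := exists_cover_of_not_isSunflowerKernel h𝓕 (hA.trans_lt hℓ) (h A hA)
      exact ⟨T, fun _ => hT⟩
    · exact ⟨∅, fun h => absurd h hA⟩
  choose T hT using hT
  have he : ∀ F : Finset α, ∃ e : α → Fin k, F ∈ 𝓕 → Set.InjOn e F := by
    intro F
    by_cases hF : F ∈ 𝓕
    · obtain ⟨e, he⟩ := exists_injOn_fin hk F (h𝓕 F hF)
      exact ⟨e, fun _ => he⟩
    · exact ⟨fun _ => ⟨0, hk⟩, fun h => absurd h hF⟩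
  choose e he using he
  obtain ⟨P, hP⟩ := exists_reedSolomon (ℓ := ℓ) hkq
  let V : Finset α := 𝓕.biUnion id
  have hV : ∀ F ∈ 𝓕, F ⊆ V := fun F hF => subset_biUnion_of_mem id hF
  let U : Finset α → Finset α := fun F => (F.powersetCard ℓ).biUnion T
  have hU : ∀ F ∈ 𝓕, 2 * (U F).card ≤ Fintype.card (ZMod q) := by
    intro F hF
    have h₁ : (U F).card ≤ (F.powersetCard ℓ).card * (m * k) :=
      card_biUnion_le_card_mul _ _ _ fun A hA => (hT A (mem_powersetCard.1 hA).2).1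
    have h₂ : (F.powersetCard ℓ).card ≤ 2 ^ k := by
      rw [card_powersetCard, h𝓕 F hF]
      exact Nat.choose_le_two_pow k ℓ
    rw [ZMod.card]
    exact (Nat.mul_le_mul_left 2 (h₁.trans (Nat.mul_le_mul_right _ h₂))).trans hq
  let B : Finset α → (Fin ℓ → ZMod q) → Finset (V → Fin k × ZMod q) := fun F p =>
    Fintype.piFinset fun v : V => allowedColours F (U F) (e F) (P p) v
  have hB : ∀ F ∈ 𝓕, ∀ p χ, χ ∈ B F p → ∀ v (hv : v ∈ F) (hvV : v ∈ V),
      χ ⟨v, hvV⟩ = (e F v, P p (e F v)) := by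
    intro F _ p χ hχ v hv hvV
    have := Fintype.mem_piFinset.1 hχ ⟨v, hvV⟩
    simpa [allowedColours, hv] using this
  have hagree : ∀ F ∈ 𝓕, ∀ G ∈ 𝓕, ∀ p p' χ, χ ∈ B F p → χ ∈ B G p' →
      ℓ ≤ (F ∩ G).card → p = p' := by
    intro F hF G hG p p' χ hp hp' hcard
    refine hP p p' ((F ∩ G).image (e F)) ?_ ?_
    · rwa [card_image_of_injOn ((he F hF).mono (by exact_mod_cast inter_subset_left))]
    · intro i hi
      obtain ⟨v, hv, rfl⟩ := mem_image.1 hi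
      obtain ⟨hvF, hvG⟩ := mem_inter.1 hv
      have h₁ := (hB F hF p χ hp v hvF (hV F hF hvF)).symm.trans
        (hB G hG p' χ hp' v hvG (hV F hF hvF))
      rw [Prod.mk.injEq] at h₁
      rw [h₁.2, h₁.1]
  obtain ⟨χ, hχ⟩ := exists_le_card_filter 𝓕 (fun F χ => ∃ p, χ ∈ B F p)
    (δ := (q : ℝ) ^ ℓ / (2 * ((k * q : ℕ) : ℝ) ^ k)) (by
      intro F hF
      have hfilter : (univ.filter fun χ => ∃ p, χ ∈ B F p) = univ.biUnion (B F) := by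
        ext; simp
      rw [hfilter, card_biUnion, Nat.cast_sum]
      · have hle := sum_le_sum fun p (_ : p ∈ (univ : Finset (Fin ℓ → ZMod q))) =>
          le_card_piFinset_allowedColours (e F) (P p) (hV F hF) (hU F hF)
        refine le_trans (le_of_eq ?_) hle
        simp [ZMod.card, h𝓕 F hF]
        ring
      · intro p _ p' _ hne
        rw [Function.onFun, disjoint_left]
        intro χ hp hp'
        refine hne (hagree F hF F hF p p' χ hp hp' ?_)
        rw [inter_self, h𝓕 F hF]
        exact hℓ.le)
  refine ⟨_, filter_subset _ _, hχ, ?_⟩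
  intro F hF G hG hne hcard
  obtain ⟨hF, p, hp⟩ := mem_filter.1 hF
  obtain ⟨hG, p', hp'⟩ := mem_filter.1 hG
  obtain rfl := hagree F hF G hG p p' χ hp hp' hcard.ge
  obtain ⟨v, hvG, hvT, hvA⟩ := (hT _ hcard).2 G hG inter_subset_right
  have hvF : v ∉ F := fun hvF => hvA (mem_inter.2 ⟨hvF, hvG⟩)
  have hvU : v ∈ U F :=
    mem_biUnion.2 ⟨F ∩ G, mem_powersetCard.2 ⟨inter_subset_left, hcard⟩, hvT⟩
  have h₁ := Fintype.mem_piFinset.1 hp ⟨v, hV G hG hvG⟩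
  simp only [allowedColours, hvF, hvU, if_true, if_false, mem_filter, mem_univ, true_and] at h₁
  rw [hB G hG p χ hp' v hvG] at h₁
  exact h₁ rfl

theorem stmt_7 (k : ℕ) (hk : 1 ≤ k) :
    ∃ c : ℝ, 0 < c ∧
      ∀ (α : Type) [DecidableEq α] (m ℓ : ℕ), 2 ≤ m → 1 ≤ ℓ → ℓ ≤ k - 1 →
        ∀ 𝓕 : Finset (Finset α), (∀ F ∈ 𝓕, F.card = k) →
          (∀ A : Finset α, A.card = ℓ → ¬ IsSunflowerKernel 𝓕 m A) →
          ∃ 𝓕' ⊆ 𝓕,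
            c * ((m : ℝ))⁻¹ ^ (k - ℓ) * (𝓕.card : ℝ) ≤ (𝓕'.card : ℝ) ∧
            ∀ F₁ ∈ 𝓕', ∀ F₂ ∈ 𝓕', F₁ ≠ F₂ → (F₁ ∩ F₂).card ≠ ℓ := by
  have hk0 : (0 : ℝ) < k := by exact_mod_cast hk
  have hk1 : (1 : ℝ) ≤ k := by exact_mod_cast hk
  set D : ℝ := 4 * 2 ^ k * k with hD
  have hD1 : 1 ≤ D := by
    have : (1 : ℝ) ≤ 2 ^ k := one_le_pow₀ (by norm_num)
    nlinarith
  have hD0 : 0 < D := by linarith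
  refine ⟨1 / (2 * (k : ℝ) ^ k * D ^ k), by positivity, ?_⟩
  intro α _ m ℓ hm hℓ1 hℓk 𝓕 h𝓕 h
  have hm0 : (0 : ℝ) < m := by exact_mod_cast (by omega : 0 < m)
  have hmk : 0 < m * k := Nat.mul_pos (by omega) hk
  obtain ⟨q, hqp, hq1, hq2⟩ := Nat.exists_prime_lt_and_le_two_mul (2 * (2 ^ k * (m * k)))
    (by positivity)
  have : Fact q.Prime := ⟨hqp⟩
  have hkq : k ≤ q := by
    have h₁ : k ≤ m * k := Nat.le_mul_of_pos_left k (by omega)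
    have h₂ : m * k ≤ 2 ^ k * (m * k) := Nat.le_mul_of_pos_left _ (by positivity)
    omega
  obtain ⟨𝓕', hsub, hcard, havoid⟩ :=
    exists_subfamily_avoiding hk (by omega) hkq hq1.le 𝓕 h𝓕 h
  refine ⟨𝓕', hsub, le_trans (mul_le_mul_of_nonneg_right ?_ (by positivity)) hcard, havoid⟩
  have hq0 : (0 : ℝ) < q := by exact_mod_cast hqp.pos
  have hqD : (q : ℝ) ≤ D * m := by
    have : (q : ℝ) ≤ 2 * (2 * (2 ^ k * (m * k))) := by exact_mod_cast hq2
    rw [hD]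
    linarith
  have hpow : (q : ℝ) ^ (k - ℓ) ≤ D ^ k * (m : ℝ) ^ (k - ℓ) := by
    calc (q : ℝ) ^ (k - ℓ) ≤ (D * m) ^ (k - ℓ) := pow_le_pow_left₀ hq0.le hqD _
      _ = D ^ (k - ℓ) * (m : ℝ) ^ (k - ℓ) := mul_pow _ _ _
      _ ≤ _ := mul_le_mul_of_nonneg_right (pow_le_pow_right₀ hD1 (Nat.sub_le _ _))
        (by positivity)
  have hsplit : (q : ℝ) ^ k = q ^ (k - ℓ) * q ^ ℓ := by
    rw [← pow_add, Nat.sub_add_cancel (by omega)]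
  calc 1 / (2 * (k : ℝ) ^ k * D ^ k) * (m : ℝ)⁻¹ ^ (k - ℓ)
      = 1 / (2 * (k : ℝ) ^ k * (D ^ k * (m : ℝ) ^ (k - ℓ))) := by
        rw [inv_pow]; field_simp
    _ ≤ 1 / (2 * (k : ℝ) ^ k * (q : ℝ) ^ (k - ℓ)) := by gcongr
    _ = (q : ℝ) ^ ℓ / (2 * ((k * q : ℕ) : ℝ) ^ k) := by
        rw [Nat.cast_mul, mul_pow, hsplit]; field_simp
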